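/- Let G = (V_1, V_2; E) be a finite bipartite graph and, for each vertex v ∈ V_1 ∪ V_2, let M_v = (δ_G(v), 𝓘_v, ≻_v) be an ordered matroid on the set δ_G(v) of edges incident to v. Let M_1 = (E, 𝓘_1) be the direct sum of the matroids M_v over v ∈ V_1, with ≻_1 any linear order on E extending each ≻_v (v ∈ V_1), and define M_2 = (E, 𝓘_2) with ≻_2 analogously from V_2. Then an edge set I ⊆ E is a stable matching of the matroid-constrained instance if and only if I is an (M_1, M_2)-kernel; in particular, this holds for every choice of the extensions ≻_1 and ≻_2. -/

import Mathlib

open Finset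
open scoped Classical

noncomputable section

/-- A matroid on the finite ground set `α`, given by its independence predicate on finsets. -/
structure FinMatroid (α : Type*) [DecidableEq α] where
  Indep : Finset α → Prop
  exists_indep : ∃ I, Indep I
  indep_subset : ∀ ⦃I J : Finset α⦄, I ⊆ J → Indep J → Indep I
  indep_exchange : ∀ ⦃I J : Finset α⦄, Indep I → Indep J → I.card < J.card →
    ∃ v ∈ J \ I, Indep (insert v I)

/-- Independence in the direct sum over the vertices on one side: `X` is independent iff its
restriction to each star `δ(v)` (cut out by the endpoint map `f`) is independent in `Mv v`. -/
def dsIndep {E V : Type*} [DecidableEq E] (f : E → V) (Mv : V → FinMatroid E)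
    (X : Finset E) : Prop :=
  ∀ v : V, (Mv v).Indep (X.filter fun e => f e = v)

/-- The edge `e ∉ I` is dominated at its endpoint `f e` (w.r.t. the local matroid and the local
order `ov`, where `ov v u e` means `u ≻_v e`): `(I ∩ δ(f e)) + e` is dependent and `u ≻_{f e} e`
for every `u ∈ I ∩ δ(f e)` with `(I ∩ δ(f e)) - u + e` independent. -/
def DomAt {E V : Type*} [DecidableEq E] (f : E → V) (Mv : V → FinMatroid E)
    (ov : V → E → E → Prop) (I : Finset E) (e : E) : Prop :=
  ¬ (Mv (f e)).Indep (insert e (I.filter fun e' => f e' = f e)) ∧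
  ∀ u ∈ I.filter fun e' => f e' = f e,
    (Mv (f e)).Indep (insert e ((I.filter fun e' => f e' = f e).erase u)) → ov (f e) u e

/-- `v ∉ I` is dominated by `I` with respect to an independence predicate `Ind` and an order
`gt` (`gt a b` meaning `a ≻ b`). -/
def Dominated {β : Type*} [DecidableEq β] (Ind : Finset β → Prop) (gt : β → β → Prop)
    (I : Finset β) (v : β) : Prop :=
  ¬ Ind (insert v I) ∧ ∀ u ∈ I, Ind (insert v (I.erase u)) → gt u v

/-- Adding `e` to a set independent in the direct sum only has to be tested at the star of `e`. -/
theorem dsIndep_insert_iff {E V : Type*} [DecidableEq E] {f : E → V} {Mv : V → FinMatroid E}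
    {X : Finset E} (hX : dsIndep f Mv X) (e : E) :
    dsIndep f Mv (insert e X) ↔
      (Mv (f e)).Indep (insert e (X.filter fun e' => f e' = f e)) := by
  constructor
  · intro h
    simpa only [Finset.filter_insert, if_true] using h (f e)
  · intro h v
    rw [Finset.filter_insert]
    split_ifs with hv
    · subst hv
      exact h
    · exact hX v

theorem dsIndep_subset {E V : Type*} [DecidableEq E] {f : E → V} {Mv : V → FinMatroid E}
    {X Y : Finset E} (hXY : X ⊆ Y) (hY : dsIndep f Mv Y) : dsIndep f Mv X :=
  fun v => (Mv v).indep_subset (Finset.filter_subset_filter _ hXY) (hY v)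

/-- Domination at an endpoint is domination in the direct sum. -/
theorem domAt_iff_dominated {E V : Type*} [DecidableEq E] {f : E → V} {Mv : V → FinMatroid E}
    {ov : V → E → E → Prop} {gt : E → E → Prop}
    (hext : ∀ e e' : E, f e = f e' → (gt e e' ↔ ov (f e) e e'))
    {I : Finset E} (hI : dsIndep f Mv I) (e : E) :
    DomAt f Mv ov I e ↔ Dominated (dsIndep f Mv) gt I e := by
  unfold DomAt Dominated
  rw [dsIndep_insert_iff hI]
  refine and_congr_right fun hdep => forall_congr' fun u => ?_
  rw [dsIndep_insert_iff (dsIndep_subset (Finset.erase_subset u I) hI), Finset.mem_filter,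
    Finset.filter_erase]
  by_cases hu : f u = f e
  · rw [hext u e hu, hu]
    simp only [and_true]
  · have hmem : u ∉ I.filter fun e' => f e' = f e := fun h => hu (Finset.mem_filter.mp h).2
    rw [Finset.erase_eq_of_notMem hmem]
    exact ⟨fun _ _ h => absurd h hdep, fun _ h => absurd h.2 hu⟩

/-- Let `G = (V₁, V₂; E)` be a bipartite graph (`left`/`right` endpoint maps),
with an ordered matroid `(δ(v), 𝓘_v, ≻_v)` at each vertex (`Mv₁ v`/`Mv₂ v` with support in the
star of `v`, and local orders `ov₁ v`/`ov₂ v`).  Let `M₁` be the direct sum of the matroids on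
`V₁` with `gt₁` any strict linear order on `E` extending every `≻_v` (`v ∈ V₁`), and similarly
`M₂`, `gt₂` from `V₂`.  Then `I ⊆ E` is a stable matching of the matroid-constrained instance
iff `I` is an `(M₁, M₂)`-kernel — for every choice of the extensions `gt₁`, `gt₂`. -/
theorem stmt_15 {V₁ V₂ E : Type*} [DecidableEq E] [Fintype E] [DecidableEq V₁] [DecidableEq V₂]
    (left : E → V₁) (right : E → V₂)
    (Mv₁ : V₁ → FinMatroid E) (Mv₂ : V₂ → FinMatroid E)
    (hsupp₁ : ∀ v : V₁, ∀ X : Finset E, (Mv₁ v).Indep X → ∀ e ∈ X, left e = v)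
    (hsupp₂ : ∀ v : V₂, ∀ X : Finset E, (Mv₂ v).Indep X → ∀ e ∈ X, right e = v)
    (ov₁ : V₁ → E → E → Prop) (ov₂ : V₂ → E → E → Prop)
    (gt₁ gt₂ : E → E → Prop)
    (h₁ : IsStrictTotalOrder E gt₁) (h₂ : IsStrictTotalOrder E gt₂)
    (hext₁ : ∀ e f : E, left e = left f → (gt₁ e f ↔ ov₁ (left e) e f))
    (hext₂ : ∀ e f : E, right e = right f → (gt₂ e f ↔ ov₂ (right e) e f))
    (I : Finset E) :
    -- `I` is a stable matching …
    (dsIndep left Mv₁ I ∧ dsIndep right Mv₂ I ∧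
      ∀ e ∉ I, DomAt left Mv₁ ov₁ I e ∨ DomAt right Mv₂ ov₂ I e) ↔
    -- … iff `I` is an `(M₁, M₂)`-kernel
    (dsIndep left Mv₁ I ∧ dsIndep right Mv₂ I ∧
      ∀ e ∉ I, Dominated (dsIndep left Mv₁) gt₁ I e ∨
        Dominated (dsIndep right Mv₂) gt₂ I e) := by
  refine and_congr_right fun hI₁ => and_congr_right fun hI₂ => forall₂_congr fun e _ => ?_
  rw [domAt_iff_dominated hext₁ hI₁, domAt_iff_dominated hext₂ hI₂]

end
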